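/- Let D, D′ ⊆ 2^[n] be domains such that every X ∈ D is weakly separated from every Y ∈ D′. If F is a maximal w-collection in D and G is a maximal w-collection in D′, then F ∩ G = D ∩ D′ and F ∪ G is a maximal w-collection in D ∪ D′. -/

import Mathlib

open Finset

/-- max of a finite set of naturals, with the convention `max0 ∅ = 0`. -/
def max0 (A : Finset ℕ) : ℕ := if h : A.Nonempty then A.max' h else 0

/-- min of a finite set of naturals, with the convention `min0 ∅ = 0`. -/
def min0 (A : Finset ℕ) : ℕ := if h : A.Nonempty then A.min' h else 0

/-- `A < B` : global dominating, i.e. `max A < min B` (with `min ∅ = max ∅ = 0`). -/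
def SetLT (A B : Finset ℕ) : Prop := max0 A < min0 B

/-- `A ⋖ B` : global dominating after cancelations, i.e. `(A − B) < (B − A)`. -/
def LessDot (A B : Finset ℕ) : Prop := SetLT (A \ B) (B \ A)

/-- `A ▷ B` (splitting): `A − B ≠ ∅` and `B − A` is a union of nonempty subsets
`B′, B″` with `B′ < (A − B) < B″`. -/
def Splits (A B : Finset ℕ) : Prop :=
  (A \ B).Nonempty ∧ ∃ B' B'' : Finset ℕ, B'.Nonempty ∧ B''.Nonempty ∧
    B' ∪ B'' = B \ A ∧ SetLT B' (A \ B) ∧ SetLT (A \ B) B''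

/-- `A` and `B` are strongly separated. -/
def StronglySep (A B : Finset ℕ) : Prop := LessDot A B ∨ LessDot B A ∨ A = B

/-- `A` and `B` are weakly separated. -/
def WeaklySep (A B : Finset ℕ) : Prop :=
  StronglySep A B ∨ (Splits A B ∧ B.card ≤ A.card) ∨ (Splits B A ∧ A.card ≤ B.card)

/-- a w-collection: members are pairwise weakly separated. -/
def IsWColl (F : Finset (Finset ℕ)) : Prop := ∀ A ∈ F, ∀ B ∈ F, WeaklySep A B

/-- a maximal w-collection in the domain `D`. -/
def IsMaxWColl (D : Set (Finset ℕ)) (F : Finset (Finset ℕ)) : Prop :=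
  ↑F ⊆ D ∧ IsWColl F ∧
    ∀ G : Finset (Finset ℕ), ↑G ⊆ D → IsWColl G → F ⊆ G → F = G

/-- the domain `D` is w-pure: all maximal w-collections in `D` have the same cardinality. -/
def WPure (D : Set (Finset ℕ)) : Prop :=
  ∀ F G : Finset (Finset ℕ), IsMaxWColl D F → IsMaxWColl D G → F.card = G.card

/-- an s-collection: members are pairwise strongly separated. -/
def IsSColl (F : Finset (Finset ℕ)) : Prop := ∀ A ∈ F, ∀ B ∈ F, StronglySep A B

/-- a maximal s-collection in the domain `D`. -/
def IsMaxSColl (D : Set (Finset ℕ)) (F : Finset (Finset ℕ)) : Prop :=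
  ↑F ⊆ D ∧ IsSColl F ∧
    ∀ G : Finset (Finset ℕ), ↑G ⊆ D → IsSColl G → F ⊆ G → F = G

/-- the domain `D` is s-pure: all maximal s-collections in `D` have the same cardinality. -/
def SPure (D : Set (Finset ℕ)) : Prop :=
  ∀ F G : Finset (Finset ℕ), IsMaxSColl D F → IsMaxSColl D G → F.card = G.card

theorem WeaklySep.refl (A : Finset ℕ) : WeaklySep A A :=
  Or.inl (Or.inr (Or.inr rfl))

theorem WeaklySep.symm {A B : Finset ℕ} (h : WeaklySep A B) : WeaklySep B A := by
  rcases h with (h | h | h) | h | h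
  · exact Or.inl (Or.inr (Or.inl h))
  · exact Or.inl (Or.inl h)
  · exact Or.inl (Or.inr (Or.inr h.symm))
  · exact Or.inr (Or.inr h)
  · exact Or.inr (Or.inl h)

/-- A member of the domain that is weakly separated from every member of a maximal
w-collection belongs to that collection. -/
theorem IsMaxWColl.mem_of_forall_weaklySep {D : Set (Finset ℕ)} {F : Finset (Finset ℕ)}
    (hF : IsMaxWColl D F) {X : Finset ℕ} (hX : X ∈ D) (h : ∀ A ∈ F, WeaklySep A X) :
    X ∈ F := by
  obtain ⟨hFD, hFw, hmax⟩ := hF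
  rw [hmax (insert X F) ?_ ?_ (subset_insert X F)]
  · exact mem_insert_self X F
  · rw [coe_insert]
    exact Set.insert_subset hX hFD
  · intro A hA B hB
    rcases mem_insert.1 hA with rfl | hAF <;> rcases mem_insert.1 hB with rfl | hBF
    · exact WeaklySep.refl _
    · exact (h B hBF).symm
    · exact h A hAF
    · exact hFw A hAF B hBF

/-- if every member of `D` is weakly separated from every member of
`D′`, `F` is a maximal w-collection in `D` and `G` is a maximal w-collection in
`D′`, then `F ∩ G = D ∩ D′` and `F ∪ G` is a maximal w-collection in `D ∪ D′`. -/
theorem complementary_pair_union (n : ℕ) (hn : 1 ≤ n) (D D' : Set (Finset ℕ))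
    (hD : ∀ X ∈ D, X ⊆ Finset.Icc 1 n) (hD' : ∀ Y ∈ D', Y ⊆ Finset.Icc 1 n)
    (hsep : ∀ X ∈ D, ∀ Y ∈ D', WeaklySep X Y)
    (F G : Finset (Finset ℕ)) (hF : IsMaxWColl D F) (hG : IsMaxWColl D' G) :
    (↑F ∩ ↑G : Set (Finset ℕ)) = D ∩ D' ∧ IsMaxWColl (D ∪ D') (F ∪ G) := by
  have hFD : ∀ A ∈ F, A ∈ D := fun A hA => hF.1 hA
  have hGD : ∀ B ∈ G, B ∈ D' := fun B hB => hG.1 hB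
  refine ⟨Set.Subset.antisymm (Set.inter_subset_inter hF.1 hG.1) ?_, ?_, ?_, ?_⟩
  · rintro X ⟨hX, hX'⟩
    exact ⟨hF.mem_of_forall_weaklySep hX fun A hA => hsep A (hFD A hA) X hX',
      hG.mem_of_forall_weaklySep hX' fun B hB => (hsep X hX B (hGD B hB)).symm⟩
  · rw [coe_union]
    exact Set.union_subset_union hF.1 hG.1
  · intro A hA B hB
    rcases mem_union.1 hA with hA | hA <;> rcases mem_union.1 hB with hB | hB
    · exact hF.2.1 A hA B hB
    · exact hsep A (hFD A hA) B (hGD B hB)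
    · exact (hsep B (hFD B hB) A (hGD A hA)).symm
    · exact hG.2.1 A hA B hB
  · intro H hHD hHw hH
    refine Subset.antisymm hH fun X hX => ?_
    rcases hHD hX with hXD | hXD
    · exact mem_union_left _ <| hF.mem_of_forall_weaklySep hXD fun A hA =>
        hHw A (hH (mem_union_left _ hA)) X hX
    · exact mem_union_right _ <| hG.mem_of_forall_weaklySep hXD fun B hB =>
        hHw B (hH (mem_union_right _ hB)) X hX
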